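/- Let n ≥ 1 and s > n + 1. There is a constant C depending only on n and s such that the following holds. Let μ be a finite positive Borel measure on ℝ^{n+1} whose support has parabolic diameter at most d and which satisfies μ(B_p(x̄,r)) ≤ r^s for all x̄ ∈ ℝ^{n+1} and r > 0. Then for every x̄ ∈ ℝ^{n+1}, |∇_x W * μ(x̄)| ≤ C d^{s-(n+1)}. -/

import Mathlib

open MeasureTheory Real Set

noncomputable section

/-- The spatial factor `ℝⁿ`. -/
abbrev Spc (n : ℕ) := EuclideanSpace ℝ (Fin n)

/-- The parabolic space `ℝ^{n+1} = ℝⁿ × ℝ`, points `x̄ = (x, t)`. -/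
abbrev Pt (n : ℕ) := Spc n × ℝ

/-- The parabolic norm `|x̄|_p = max (|x|, |t|^{1/2})`. -/
def pnorm {n : ℕ} (p : Pt n) : ℝ := max ‖p.1‖ (Real.sqrt |p.2|)

/-- The parabolic ball of center `c` and radius `r`. -/
def pball {n : ℕ} (c : Pt n) (r : ℝ) : Set (Pt n) := {p | pnorm (p - c) < r}

/-- The heat kernel `W`. -/
def heatW {n : ℕ} (p : Pt n) : ℝ :=
  if 0 < p.2 then (4 * π * p.2) ^ (-(n : ℝ) / 2) * Real.exp (-‖p.1‖ ^ 2 / (4 * p.2)) else 0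

/-- The spatial gradient `∇ₓ W` of the heat kernel. -/
def gradW {n : ℕ} (p : Pt n) : Spc n :=
  if 0 < p.2 then
    (-(1 / (2 * p.2)) * (4 * π * p.2) ^ (-(n : ℝ) / 2) * Real.exp (-‖p.1‖ ^ 2 / (4 * p.2))) • p.1
  else 0

/-- Half time derivative `∂_t^{1/2} f (x,t) = ∫ (f(x,s) - f(x,t))/|s-t|^{3/2} ds`. -/
def halfT {n : ℕ} (f : Pt n → ℝ) (p : Pt n) : ℝ :=
  ∫ s : ℝ, (f (p.1, s) - f p) / |s - p.2| ^ (3 / 2 : ℝ)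

/-- A parabolic cube: product of `n` intervals of length `len` and a time interval
of length `len ^ 2`. -/
structure PCube (n : ℕ) where
  corner : Fin n → ℝ
  time : ℝ
  len : ℝ
  len_pos : 0 < len

/-- The set of points of a parabolic cube. -/
def PCube.toSet {n : ℕ} (Q : PCube n) : Set (Pt n) :=
  {p | (∀ i, p.1 i ∈ Set.Icc (Q.corner i) (Q.corner i + Q.len)) ∧
    p.2 ∈ Set.Icc Q.time (Q.time + Q.len ^ 2)}

/-- The dilation `λQ` of a parabolic cube: same center, side lengths `λ·len` and
`λ²·len²`. -/
def PCube.dilate {n : ℕ} (Q : PCube n) (lam : ℝ) (h : 0 < lam) : PCube n :=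
  ⟨fun i => Q.corner i + Q.len / 2 - lam * Q.len / 2,
    Q.time + Q.len ^ 2 / 2 - lam ^ 2 * Q.len ^ 2 / 2,
    lam * Q.len, mul_pos h Q.len_pos⟩

/-- Second directional derivative in the `i`-th spatial direction. -/
def dir2 {n : ℕ} (φ : Pt n → ℝ) (p : Pt n) (i : Fin n) : ℝ :=
  deriv (fun h : ℝ =>
    deriv (fun h' : ℝ => φ (p.1 + h' • (EuclideanSpace.single i 1 : Spc n), p.2)) h) 0

/-- Spatial Laplacian `Δₓ φ`. -/
def lapx {n : ℕ} (φ : Pt n → ℝ) (p : Pt n) : ℝ := ∑ i : Fin n, dir2 φ p i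

/-- A `C²` function `φ` is admissible for a parabolic cube `Q` if it is supported on `Q`,
`‖∇ₓ φ‖_∞ ≤ 1/ℓ(Q)` and `‖Δₓ φ‖_∞ + ‖∂_t φ‖_∞ ≤ 1/ℓ(Q)²`. -/
def Admissible {n : ℕ} (φ : Pt n → ℝ) (Q : PCube n) : Prop :=
  ContDiff ℝ 2 φ ∧ tsupport φ ⊆ Q.toSet ∧
  (∀ p : Pt n, ‖fderiv ℝ (fun y : Spc n => φ (y, p.2)) p.1‖ ≤ 1 / Q.len) ∧
  (∀ p : Pt n, |lapx φ p| + |deriv (fun s : ℝ => φ (p.1, s)) p.2| ≤ 1 / Q.len ^ 2)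

/-- The parabolic BMO norm of `f` is at most `C`. -/
def ParabBMOLe {n : ℕ} (f : Pt n → ℝ) (C : ℝ) : Prop :=
  ∀ Q : PCube n, ⨍ p in Q.toSet, |f p - ⨍ q in Q.toSet, f q| ≤ C

/-- `‖F‖_{Lip_{1/2,t}} ≤ C` : half-Lipschitz in time. -/
def LipHalfLe {n : ℕ} (F : Pt n → ℝ) (C : ℝ) : Prop :=
  ∀ (x : Spc n) (t u : ℝ), |F (x, t) - F (x, u)| ≤ C * Real.sqrt |t - u|

/-- Integral of a scalar function against a finite signed measure. -/
def sInt {n : ℕ} (ν : SignedMeasure (Pt n)) (f : Pt n → ℝ) : ℝ :=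
  ∫ y, f y ∂ν.toJordanDecomposition.posPart - ∫ y, f y ∂ν.toJordanDecomposition.negPart

/-- Integral of a vector-valued function against a finite signed measure. -/
def vInt {n : ℕ} (ν : SignedMeasure (Pt n)) (f : Pt n → Spc n) : Spc n :=
  ∫ y, f y ∂ν.toJordanDecomposition.posPart - ∫ y, f y ∂ν.toJordanDecomposition.negPart

/-- `W * ν`. -/
def convW {n : ℕ} (ν : SignedMeasure (Pt n)) (p : Pt n) : ℝ :=
  sInt ν (fun y => heatW (p - y))

/-- `∇ₓ W * ν`. -/
def convGradW {n : ℕ} (ν : SignedMeasure (Pt n)) (p : Pt n) : Spc n :=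
  vInt ν (fun y => gradW (p - y))

/-- `W * (φ ν)`, where `φν` is the measure with density `φ` w.r.t. `ν`. -/
def convWd {n : ℕ} (ν : SignedMeasure (Pt n)) (φ : Pt n → ℝ) (p : Pt n) : ℝ :=
  sInt ν (fun y => φ y * heatW (p - y))

/-- `∇ₓ W * (φ ν)`. -/
def convGradWd {n : ℕ} (ν : SignedMeasure (Pt n)) (φ : Pt n → ℝ) (p : Pt n) : Spc n :=
  vInt ν (fun y => φ y • gradW (p - y))

/-- `W * μ` for a positive measure `μ`. -/
def mconvW {n : ℕ} (μ : Measure (Pt n)) (p : Pt n) : ℝ := ∫ y, heatW (p - y) ∂μ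

/-- `∇ₓ W * μ` for a positive measure `μ`. -/
def mconvGradW {n : ℕ} (μ : Measure (Pt n)) (p : Pt n) : Spc n := ∫ y, gradW (p - y) ∂μ

/-- Upper parabolic growth of degree `n+1` with constant `1`. -/
def PGrowth {n : ℕ} (μ : Measure (Pt n)) : Prop :=
  ∀ (c : Pt n) (r : ℝ), 0 < r → μ (pball c r) ≤ ENNReal.ofReal (r ^ (n + 1))
lemma pnorm_nonneg' {n : ℕ} (p : Pt n) : 0 ≤ pnorm p := le_max_of_le_left (norm_nonneg _)

lemma pnorm_cont {n : ℕ} : Continuous (pnorm : Pt n → ℝ) := by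
  unfold pnorm
  fun_prop

lemma pnorm_sub_comm' {n : ℕ} (p q : Pt n) : pnorm (p - q) = pnorm (q - p) := by
  unfold pnorm
  rw [Prod.fst_sub, Prod.snd_sub, Prod.fst_sub, Prod.snd_sub, norm_sub_rev, abs_sub_comm]

lemma pball_meas {n : ℕ} (c : Pt n) (r : ℝ) : MeasurableSet (pball c r) := by
  have : Continuous fun p : Pt n => pnorm (p - c) := pnorm_cont.comp (by fun_prop)
  exact (isOpen_lt this continuous_const).measurableSet

lemma pnorm_eq_zero' {n : ℕ} {p : Pt n} (h : pnorm p = 0) : p = 0 := by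
  have h1 : ‖p.1‖ ≤ 0 := h ▸ le_max_left _ _
  have h2 : Real.sqrt |p.2| ≤ 0 := h ▸ le_max_right _ _
  have h3 := Real.sqrt_eq_zero'.1 (le_antisymm h2 (Real.sqrt_nonneg _))
  exact Prod.ext (norm_le_zero_iff.1 h1) (abs_eq_zero.1 (le_antisymm h3 (abs_nonneg _)))

/-- Pointwise kernel bound. -/
lemma gradW_bound (n : ℕ) : ∃ K : ℝ, 0 < K ∧ ∀ (p : Pt n) (a : ℝ), 0 < a → a ≤ pnorm p →
    ‖gradW p‖ ≤ K * a ^ (-((n : ℝ) + 1)) := by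
  refine ⟨4 ^ (n + 1) * (n + 1).factorial * Real.exp (1 / 4), by positivity, ?_⟩
  intro p a ha hap
  set K : ℝ := 4 ^ (n + 1) * (n + 1).factorial * Real.exp (1 / 4)
  have hK : 0 < K := by positivity
  unfold gradW
  split_ifs with ht
  swap
  · simp only [norm_zero]; positivity
  obtain ⟨x, t⟩ := p
  simp only at ht ⊢
  set b := pnorm ((x, t) : Pt n) with hb
  have hb0 : 0 < b := ha.trans_le hap
  have hxb : ‖x‖ ≤ b := le_max_left _ _
  have htb : t ≤ b ^ 2 := by
    have : Real.sqrt |t| ≤ b := le_max_right _ _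
    rw [abs_of_pos ht] at this
    exact (Real.sqrt_le_left hb0.le).1 this
  have hbx : b ^ 2 ≤ ‖x‖ ^ 2 + t := by
    rcases max_choice ‖x‖ (Real.sqrt |t|) with h | h
    · have : b = ‖x‖ := h
      rw [this]; linarith
    · have : b = Real.sqrt |t| := h
      rw [this, Real.sq_sqrt (abs_nonneg _), abs_of_pos ht]
      nlinarith [norm_nonneg x]
  set v := b ^ 2 / t with hv
  have hv1 : 1 ≤ v := (one_le_div ht).2 htb
  -- exponential bound
  have hexp : Real.exp (-‖x‖ ^ 2 / (4 * t)) ≤ Real.exp (1 / 4) * Real.exp (-(v / 4)) := by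
    rw [← Real.exp_add]
    apply Real.exp_le_exp.2
    rw [hv, div_le_iff₀ (by positivity)]
    have : (1 / 4 + -(b ^ 2 / t / 4)) * (4 * t) = t - b ^ 2 := by field_simp; ring
    rw [this]; linarith
  have hfac : v ^ (n + 1) * Real.exp (-(v / 4)) ≤ 4 ^ (n + 1) * (n + 1).factorial := by
    have h := Real.pow_div_factorial_le_exp (v / 4) (by positivity) (n + 1)
    rw [div_le_iff₀ (by positivity), div_pow, div_le_iff₀ (by positivity)] at h
    rw [Real.exp_neg, ← div_eq_mul_inv, div_le_iff₀ (Real.exp_pos _)]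
    linarith
  have htpow : (4 * π * t) ^ (-(n : ℝ) / 2) ≤ t ^ (-(n : ℝ) / 2) := by
    apply Real.rpow_le_rpow_of_nonpos ht
    · nlinarith [Real.pi_gt_three]
    · have : (0 : ℝ) ≤ n := Nat.cast_nonneg n
      linarith
  have hkey : b * (1 / t) * t ^ (-(n : ℝ) / 2) = b ^ (-((n : ℝ) + 1)) * v ^ ((n : ℝ) / 2 + 1) := by
    rw [hv, Real.div_rpow (by positivity) ht.le, ← Real.rpow_natCast b 2, ← Real.rpow_mul hb0.le,
      mul_div_assoc' (b ^ (-((n : ℝ) + 1))), ← Real.rpow_add hb0]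
    have e1 : -((n : ℝ) + 1) + ((2 : ℕ) : ℝ) * ((n : ℝ) / 2 + 1) = 1 := by push_cast; ring
    rw [e1, Real.rpow_one, Real.rpow_add ht, Real.rpow_one, neg_div, Real.rpow_neg ht.le]
    field_simp
  have hvv : v ^ ((n : ℝ) / 2 + 1) ≤ v ^ (n + 1) := by
    rw [← Real.rpow_natCast]
    apply Real.rpow_le_rpow_of_exponent_le hv1
    have : (0 : ℝ) ≤ n := Nat.cast_nonneg n
    push_cast; linarith
  have hT : (0 : ℝ) < (4 * π * t) ^ (-(n : ℝ) / 2) := Real.rpow_pos_of_pos (by positivity) _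
  have hT' : (0 : ℝ) < t ^ (-(n : ℝ) / 2) := Real.rpow_pos_of_pos ht _
  have hB : (0 : ℝ) < b ^ (-((n : ℝ) + 1)) := Real.rpow_pos_of_pos hb0 _
  have hab : b ^ (-((n : ℝ) + 1)) ≤ a ^ (-((n : ℝ) + 1)) :=
    Real.rpow_le_rpow_of_nonpos ha hap (by
      have : (0 : ℝ) ≤ n := Nat.cast_nonneg n
      linarith)
  have hhalf : 1 / (2 * t) ≤ 1 / t := one_div_le_one_div_of_le ht (by linarith)
  rw [norm_smul, norm_mul, norm_mul, norm_neg, Real.norm_of_nonneg (by positivity : 0 ≤ 1 / (2 * t)),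
    Real.norm_of_nonneg hT.le, Real.norm_of_nonneg (Real.exp_pos _).le]
  calc 1 / (2 * t) * (4 * π * t) ^ (-(n : ℝ) / 2) * Real.exp (-‖x‖ ^ 2 / (4 * t)) * ‖x‖
      ≤ 1 / t * t ^ (-(n : ℝ) / 2) * (Real.exp (1 / 4) * Real.exp (-(v / 4))) * b := by gcongr
    _ = (b * (1 / t) * t ^ (-(n : ℝ) / 2)) * (Real.exp (1 / 4) * Real.exp (-(v / 4))) := by ring
    _ = b ^ (-((n : ℝ) + 1)) * Real.exp (1 / 4)
          * (v ^ ((n : ℝ) / 2 + 1) * Real.exp (-(v / 4))) := by rw [hkey]; ring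
    _ ≤ b ^ (-((n : ℝ) + 1)) * Real.exp (1 / 4) * (v ^ (n + 1) * Real.exp (-(v / 4))) := by gcongr
    _ ≤ b ^ (-((n : ℝ) + 1)) * Real.exp (1 / 4) * (4 ^ (n + 1) * (n + 1).factorial) := by gcongr
    _ = K * b ^ (-((n : ℝ) + 1)) := by simp only [K]; ring
    _ ≤ K * a ^ (-((n : ℝ) + 1)) := by gcongr

lemma exists_layer {d b : ℝ} (hb : 0 < b) (hbd : b < d) :
    ∃ k : ℕ, d * (1 / 2) ^ (k + 1) ≤ b ∧ b < d * (1 / 2) ^ k := by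
  have hd : 0 < d := hb.trans hbd
  have hex : ∃ k : ℕ, d * (1 / 2) ^ (k + 1) ≤ b := by
    obtain ⟨k, hk⟩ := exists_pow_lt_of_lt_one (div_pos hb hd) (by norm_num : (1 / 2 : ℝ) < 1)
    refine ⟨k, ?_⟩
    rw [lt_div_iff₀ hd] at hk
    have : (0 : ℝ) < (1 / 2) ^ k := by positivity
    rw [pow_succ]
    nlinarith [mul_pos hd this]
  classical
  refine ⟨Nat.find hex, Nat.find_spec hex, ?_⟩
  rcases h : Nat.find hex with _ | k
  · simpa using hbd
  · exact not_le.1 (Nat.find_min hex (m := k) (by omega))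

lemma total_mass {n : ℕ} {s : ℝ} (μ : Measure (Pt n)) {d r : ℝ} (hdr : d < r) (hr : 0 < r)
    (hS : ∃ S : Set (Pt n), μ Sᶜ = 0 ∧ ∀ p ∈ S, ∀ q ∈ S, pnorm (p - q) ≤ d)
    (hg : ∀ (c : Pt n) (r : ℝ), 0 < r → μ (pball c r) ≤ ENNReal.ofReal (r ^ s)) :
    μ univ ≤ ENNReal.ofReal (r ^ s) := by
  obtain ⟨S, hS0, hSd⟩ := hS
  have h1 : μ univ ≤ μ S := by
    rw [← union_compl_self S]
    exact (measure_union_le _ _).trans (by rw [hS0, add_zero])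
  rcases S.eq_empty_or_nonempty with rfl | ⟨q, hq⟩
  · refine h1.trans ?_
    simp
  · refine h1.trans ((measure_mono ?_).trans (hg q r hr))
    intro p hp
    exact (hSd p hp q hq).trans_lt hdr

/-- if `μ` has growth `μ(B_p(x̄,r)) ≤ r^s` with `s > n+1` and its support
has parabolic diameter at most `d`, then `|∇ₓ W * μ| ≤ C d^{s-(n+1)}`. -/
theorem mconvGradW_le_of_growth (n : ℕ) (hn : 1 ≤ n) (s : ℝ) (hs : (n : ℝ) + 1 < s) :
    ∃ C : ℝ, 0 < C ∧ ∀ (μ : Measure (Pt n)) (d : ℝ), 0 ≤ d → IsFiniteMeasure μ →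
      (∃ S : Set (Pt n), μ Sᶜ = 0 ∧ ∀ p ∈ S, ∀ q ∈ S, pnorm (p - q) ≤ d) →
      (∀ (c : Pt n) (r : ℝ), 0 < r → μ (pball c r) ≤ ENNReal.ofReal (r ^ s)) →
      ∀ p : Pt n, ‖mconvGradW μ p‖ ≤ C * d ^ (s - ((n : ℝ) + 1)) := by
  obtain ⟨K, hK, hKb⟩ := gradW_bound n
  set m : ℝ := (n : ℝ) + 1 with hm
  set a : ℝ := s - m with ha
  have ha0 : 0 < a := by linarith
  set q : ℝ := (1 / 2 : ℝ) ^ a with hq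
  have hq0 : 0 < q := by positivity
  have hq1 : q < 1 := Real.rpow_lt_one (by norm_num) (by norm_num) ha0
  have hq1' : 0 < 1 - q := by linarith
  refine ⟨K * 2 ^ s + K * 2 ^ m * (1 - q)⁻¹, by positivity, ?_⟩
  intro μ d hd hfin hS hg p
  rcases hd.eq_or_lt with rfl | hd
  · have hμ : μ univ = 0 := by
      have hlim : Filter.Tendsto (fun r : ℝ => ENNReal.ofReal (r ^ s)) (nhdsWithin 0 (Ioi 0))
          (nhds 0) := by
        have h1 : Filter.Tendsto (fun r : ℝ => r ^ s) (nhds 0) (nhds (0 ^ s)) :=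
          (Real.continuousAt_rpow_const 0 s (Or.inr (by
            have : (0 : ℝ) ≤ n := Nat.cast_nonneg n
            linarith)))
        rw [Real.zero_rpow (by
            have : (0 : ℝ) ≤ n := Nat.cast_nonneg n
            linarith)] at h1
        have := (ENNReal.tendsto_ofReal h1).mono_left (nhdsWithin_le_nhds (s := Ioi 0))
        simpa using this
      refine le_antisymm (ge_of_tendsto hlim ?_) bot_le
      filter_upwards [self_mem_nhdsWithin] with r hr
      exact total_mass μ hr hr hS hg
    rw [Measure.measure_univ_eq_zero.1 hμ, mconvGradW, integral_zero_measure, norm_zero]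
    positivity
  -- main case
  set c : ℕ → ℝ := fun k => K * (d * (1 / 2) ^ (k + 1)) ^ (-m) with hc
  have hc0 : ∀ k, 0 ≤ c k := fun k => by positivity
  set g : Pt n → ENNReal := fun y => ENNReal.ofReal (K * d ^ (-m)) +
    ∑' k, (pball p (d * (1 / 2) ^ k)).indicator (fun _ => ENNReal.ofReal (c k)) y with hgdef
  have hpt : ∀ y, ‖gradW (p - y)‖ₑ ≤ g y := by
    intro y
    rw [← ofReal_norm]
    by_cases h : d ≤ pnorm (p - y)
    · exact (ENNReal.ofReal_le_ofReal (hKb _ d hd h)).trans le_self_add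
    push Not at h
    rcases (pnorm_nonneg' (p - y)).eq_or_lt with h0 | h0
    · rw [pnorm_eq_zero' h0.symm]
      simp [gradW]
    obtain ⟨k, hk1, hk2⟩ := exists_layer h0 h
    refine le_trans ?_ (le_trans (ENNReal.le_tsum k) le_add_self)
    rw [indicator_of_mem (by
      change pnorm (y - p) < _
      rwa [pnorm_sub_comm'])]
    exact ENNReal.ofReal_le_ofReal (hKb _ _ (by positivity) hk1)
  have hterm : ∀ k : ℕ, c k * (d * (1 / 2) ^ k) ^ s = K * 2 ^ m * d ^ a * q ^ k := by
    intro k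
    have e : (0 : ℝ) < d * (1 / 2) ^ k := by positivity
    have e1 : d * (1 / 2 : ℝ) ^ (k + 1) = (d * (1 / 2) ^ k) * 2⁻¹ := by ring
    have e2 : (d * (1 / 2 : ℝ) ^ k) ^ a = d ^ a * q ^ k := by
      rw [Real.mul_rpow hd.le (by positivity), hq, ← Real.rpow_natCast, ← Real.rpow_natCast,
        ← Real.rpow_mul (by norm_num), ← Real.rpow_mul (by norm_num), mul_comm (k : ℝ)]
    have e3 : (2⁻¹ : ℝ) ^ (-m) = 2 ^ m := by
      rw [Real.inv_rpow (by norm_num), Real.rpow_neg (by norm_num), inv_inv]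
    simp only [hc]
    rw [e1, Real.mul_rpow e.le (by norm_num), e3]
    calc _ = K * 2 ^ m * ((d * (1 / 2) ^ k) ^ (-m) * (d * (1 / 2) ^ k) ^ s) := by ring
      _ = K * 2 ^ m * (d * (1 / 2) ^ k) ^ a := by
        rw [← Real.rpow_add e, ha]; congr 2; ring
      _ = _ := by rw [e2]; ring
  have hfirst : K * d ^ (-m) * (2 * d) ^ s = K * 2 ^ s * d ^ a := by
    rw [Real.mul_rpow (by norm_num) hd.le]
    calc _ = K * 2 ^ s * (d ^ (-m) * d ^ s) := by ring
      _ = _ := by rw [← Real.rpow_add hd, ha]; congr 2; ring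
  have hint : ∫⁻ y, g y ∂μ ≤
      ENNReal.ofReal ((K * 2 ^ s + K * 2 ^ m * (1 - q)⁻¹) * d ^ a) := by
    rw [hgdef, lintegral_add_left measurable_const, lintegral_const, lintegral_tsum
      (fun k => (measurable_const.indicator (pball_meas _ _)).aemeasurable), add_mul,
      ENNReal.ofReal_add (by positivity) (by positivity)]
    gcongr
    · rw [← hfirst, ENNReal.ofReal_mul (p := K * d ^ (-m)) (q := (2 * d) ^ s) (by positivity)]
      gcongr
      exact total_mass μ (by linarith) (by positivity) hS hg
    · calc _ ≤ ∑' k : ℕ, ENNReal.ofReal (K * 2 ^ m * d ^ a * q ^ k) := by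
            refine ENNReal.tsum_le_tsum fun k => ?_
            rw [lintegral_indicator_const (pball_meas _ _), ← hterm, ENNReal.ofReal_mul (hc0 k)]
            gcongr
            exact hg _ _ (by positivity)
        _ = ENNReal.ofReal (∑' k : ℕ, K * 2 ^ m * d ^ a * q ^ k) :=
            (ENNReal.ofReal_tsum_of_nonneg (fun k => by positivity)
              ((summable_geometric_of_lt_one hq0.le hq1).mul_left _)).symm
        _ = _ := by
            rw [tsum_mul_left, tsum_geometric_of_lt_one hq0.le hq1]
            congr 1; ring
        _ ≤ _ := le_rfl
  have hfinal : ‖mconvGradW μ p‖ₑ ≤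
      ENNReal.ofReal ((K * 2 ^ s + K * 2 ^ m * (1 - q)⁻¹) * d ^ a) :=
    (enorm_integral_le_lintegral_enorm _).trans ((lintegral_mono hpt).trans hint)
  rw [← ofReal_norm] at hfinal
  exact (ENNReal.ofReal_le_ofReal_iff (by positivity)).1 hfinal
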